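/- arXiv:2104.07781 — 3 statements merged into one kernel-verified Lean document; each statement's English description precedes it below -/
import Mathlib

section
/- Suppose x : ℝ → ℝ^N is differentiable and satisfies x'(t) = −(Lᴵ + Lᴱ) x(t) for all t. Define y(t) = P⁻¹Uᵀx(t) and e_x(t) = W x(t). Then e_x is differentiable and its derivative satisfies e_x'(t) = −W Lᴵ e_x(t) − W Lᴱ e_x(t) − W Lᴱ U y(t) for all t. -/
open Matrix

noncomputable section

/-- The node set of a network of `r` clusters with sizes `Nv α`. -/
abbrev ClusterNode (r : ℕ) (Nv : Fin r → ℕ) := (α : Fin r) × Fin (Nv α)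

/-- `U = diag(1_{N_1},…,1_{N_r}) ∈ ℝ^{N×r}`, the block-diagonal matrix whose
`α`-th column block is the all-ones vector `1_{N_α}`. -/
def clusterU (r : ℕ) (Nv : Fin r → ℕ) : Matrix (ClusterNode r Nv) (Fin r) ℝ :=
  Matrix.of fun v β => if v.1 = β then (1 : ℝ) else 0

/-- `P = diag(N_1,…,N_r) ∈ ℝ^{r×r}`. -/
def clusterP (r : ℕ) (Nv : Fin r → ℕ) : Matrix (Fin r) (Fin r) ℝ :=
  Matrix.diagonal fun α => (Nv α : ℝ)

/-- `P⁻¹ = diag(1/N_1,…,1/N_r) ∈ ℝ^{r×r}`. -/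
def clusterPinv (r : ℕ) (Nv : Fin r → ℕ) : Matrix (Fin r) (Fin r) ℝ :=
  Matrix.diagonal fun α => ((Nv α : ℝ))⁻¹

/-- The centering matrix `W_n = I_n − (1/n) 1_n 1_nᵀ`. -/
def centering (n : ℕ) : Matrix (Fin n) (Fin n) ℝ :=
  (1 : Matrix (Fin n) (Fin n) ℝ) - ((n : ℝ)⁻¹) • Matrix.of fun _ _ => (1 : ℝ)

/-- `W = diag(W_1,…,W_r)` the block-diagonal centering matrix. -/
def clusterW (r : ℕ) (Nv : Fin r → ℕ) : Matrix (ClusterNode r Nv) (ClusterNode r Nv) ℝ :=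
  Matrix.blockDiagonal' fun α => centering (Nv α)

/-- The slow variable `y = P⁻¹ Uᵀ x`. -/
def slowVar (r : ℕ) (Nv : Fin r → ℕ) (x : ClusterNode r Nv → ℝ) : Fin r → ℝ :=
  clusterPinv r Nv *ᵥ ((clusterU r Nv)ᵀ *ᵥ x)

/-- The fast variable `e_x = W x`. -/
def fastVar (r : ℕ) (Nv : Fin r → ℕ) (x : ClusterNode r Nv → ℝ) : ClusterNode r Nv → ℝ :=
  clusterW r Nv *ᵥ x

/-- The inter-area variable `e_y = W_r y`. -/
def interArea (r : ℕ) (Nv : Fin r → ℕ) (x : ClusterNode r Nv → ℝ) : Fin r → ℝ :=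
  centering r *ᵥ slowVar r Nv x

theorem Matrix.blockDiagonal'_mulVec_mk {o R : Type*} {n : o → Type*} [Fintype o] [DecidableEq o]
    [∀ i, Fintype (n i)] [NonUnitalNonAssocSemiring R] (M : ∀ i, Matrix (n i) (n i) R)
    (v : (Σ i, n i) → R) (a : o) (i : n a) :
    (Matrix.blockDiagonal' M *ᵥ v) ⟨a, i⟩ = (M a *ᵥ fun j => v ⟨a, j⟩) i := by
  simp only [Matrix.mulVec, dotProduct, Fintype.sum_sigma]
  rw [Finset.sum_eq_single a]
  · simp [Matrix.blockDiagonal'_apply_eq]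
  · intro b _ hb
    simp [Matrix.blockDiagonal'_apply_ne M _ _ hb.symm]
  · simp

theorem clusterU_mulVec_mk (r : ℕ) (Nv : Fin r → ℕ) (y : Fin r → ℝ) (v : ClusterNode r Nv) :
    (clusterU r Nv *ᵥ y) v = y v.1 := by
  simp [clusterU, Matrix.mulVec, dotProduct]

theorem slowVar_apply (r : ℕ) (Nv : Fin r → ℕ) (x : ClusterNode r Nv → ℝ) (a : Fin r) :
    slowVar r Nv x a = (Nv a : ℝ)⁻¹ * ∑ j, x ⟨a, j⟩ := by
  rw [slowVar, clusterPinv, Matrix.mulVec_diagonal]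
  congr 1
  simp only [clusterU, Matrix.mulVec, dotProduct, Matrix.transpose_apply, Matrix.of_apply,
    Fintype.sum_sigma]
  rw [Finset.sum_eq_single a]
  · simp
  · intro b _ hb
    simp [hb]
  · simp

theorem fastVar_add_clusterU_mulVec_slowVar (r : ℕ) (Nv : Fin r → ℕ) (x : ClusterNode r Nv → ℝ) :
    fastVar r Nv x + clusterU r Nv *ᵥ slowVar r Nv x = x := by
  ext ⟨a, i⟩
  rw [Pi.add_apply, clusterU_mulVec_mk, slowVar_apply, fastVar, clusterW,
    Matrix.blockDiagonal'_mulVec_mk, centering, Matrix.sub_mulVec, Matrix.smul_mulVec]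
  simp [Matrix.mulVec, dotProduct]

theorem blockDiagonal'_mulVec_clusterU_mulVec (r : ℕ) (Nv : Fin r → ℕ)
    (Lb : ∀ α : Fin r, Matrix (Fin (Nv α)) (Fin (Nv α)) ℝ)
    (hLb1 : ∀ α, Lb α *ᵥ (fun _ => (1 : ℝ)) = 0) (y : Fin r → ℝ) :
    Matrix.blockDiagonal' Lb *ᵥ (clusterU r Nv *ᵥ y) = 0 := by
  ext ⟨a, i⟩
  have h : (fun j => (clusterU r Nv *ᵥ y) ⟨a, j⟩) = y a • fun _ : Fin (Nv a) => (1 : ℝ) := by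
    ext j
    simp [clusterU_mulVec_mk]
  rw [Matrix.blockDiagonal'_mulVec_mk, h, Matrix.mulVec_smul, hLb1]
  simp

/-- Lemma 1, equation (14): along the consensus dynamics `x' = −(Lᴵ + Lᴱ)x`,
the fast variable `e_x = W x` is differentiable with
`e_x' = −W Lᴵ e_x − W Lᴱ e_x − W Lᴱ U y`. -/
theorem fastVar_dynamics
    (r : ℕ) (Nv : Fin r → ℕ) (hNv : ∀ α, 0 < Nv α)
    (Lb : ∀ α : Fin r, Matrix (Fin (Nv α)) (Fin (Nv α)) ℝ)
    (hLb : ∀ α, (Lb α).PosSemidef)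
    (hLb1 : ∀ α, Lb α *ᵥ (fun _ => (1 : ℝ)) = 0)
    (LE : Matrix (ClusterNode r Nv) (ClusterNode r Nv) ℝ)
    (hLE : LE.PosSemidef)
    (hLE1 : LE *ᵥ (fun _ => (1 : ℝ)) = 0)
    (x : ℝ → ClusterNode r Nv → ℝ)
    (hx : ∀ t : ℝ, HasDerivAt x (-((Matrix.blockDiagonal' Lb + LE) *ᵥ x t)) t) :
    ∀ t : ℝ, HasDerivAt (fun s => fastVar r Nv (x s))
      (-(clusterW r Nv *ᵥ (Matrix.blockDiagonal' Lb *ᵥ fastVar r Nv (x t)))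
        - clusterW r Nv *ᵥ (LE *ᵥ fastVar r Nv (x t))
        - clusterW r Nv *ᵥ (LE *ᵥ (clusterU r Nv *ᵥ slowVar r Nv (x t)))) t := by
  intro t
  have hI : Matrix.blockDiagonal' Lb *ᵥ x t = Matrix.blockDiagonal' Lb *ᵥ fastVar r Nv (x t) := by
    conv_lhs => rw [← fastVar_add_clusterU_mulVec_slowVar r Nv (x t)]
    rw [Matrix.mulVec_add, blockDiagonal'_mulVec_clusterU_mulVec r Nv Lb hLb1, add_zero]
  have hE : LE *ᵥ x t =
      LE *ᵥ fastVar r Nv (x t) + LE *ᵥ (clusterU r Nv *ᵥ slowVar r Nv (x t)) := by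
    rw [← Matrix.mulVec_add, fastVar_add_clusterU_mulVec_slowVar]
  have hW : HasDerivAt (fun s => fastVar r Nv (x s))
      (clusterW r Nv *ᵥ -((Matrix.blockDiagonal' Lb + LE) *ᵥ x t)) t :=
    (LinearMap.toContinuousLinearMap
      (Matrix.mulVecLin (clusterW r Nv))).hasFDerivAt.comp_hasDerivAt t (hx t)
  convert hW using 1
  rw [Matrix.add_mulVec, hI, hE, Matrix.mulVec_neg, Matrix.mulVec_add, Matrix.mulVec_add]
  abel
end
end

section
/- Let e_x ∈ ℝ^N satisfy W e_x = e_x and let e_y ∈ ℝ^r be arbitrary. Assume Lᴱ is symmetric positive semidefinite. Then the derivative of the Lyapunov function V_{e_x} = ½‖e_x‖² along the fast dynamics satisfies the bound e_xᵀ(−W Lᴵ e_x − W Lᴱ e_x − W Lᴱ U e_y) ≤ −e_xᵀ W Lᴵ e_x − ½ e_xᵀ W Lᴱ e_x + ½ e_yᵀ Uᵀ Lᴱ U e_y. -/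
open Matrix

noncomputable section

theorem centering_transpose (n : ℕ) : (centering n)ᵀ = centering n := by
  ext i j
  simp [centering, Matrix.one_apply, eq_comm]

theorem clusterW_transpose (r : ℕ) (Nv : Fin r → ℕ) :
    (clusterW r Nv)ᵀ = clusterW r Nv := by
  simp [clusterW, Matrix.blockDiagonal'_transpose, centering_transpose]

/-- Pairing with a fixed vector of `W` absorbs `W`. -/
theorem dotProduct_clusterW_mulVec {r : ℕ} {Nv : Fin r → ℕ} {e : ClusterNode r Nv → ℝ}
    (he : clusterW r Nv *ᵥ e = e) (v : ClusterNode r Nv → ℝ) :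
    e ⬝ᵥ (clusterW r Nv *ᵥ v) = e ⬝ᵥ v := by
  rw [Matrix.dotProduct_mulVec, ← Matrix.mulVec_transpose, clusterW_transpose, he]

/-- Young's inequality for a positive semidefinite quadratic form. -/
theorem Matrix.PosSemidef.neg_dotProduct_mulVec_le {n : Type*} [Fintype n]
    {A : Matrix n n ℝ} (hA : A.PosSemidef) (x z : n → ℝ) :
    -(x ⬝ᵥ (A *ᵥ z)) ≤ (1 / 2) * (x ⬝ᵥ (A *ᵥ x)) + (1 / 2) * (z ⬝ᵥ (A *ᵥ z)) := by
  have hs : Aᵀ = A := by simpa using hA.isHermitian.eq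
  have hzx : z ⬝ᵥ (A *ᵥ x) = x ⬝ᵥ (A *ᵥ z) := by
    rw [Matrix.dotProduct_mulVec, ← Matrix.mulVec_transpose, hs, dotProduct_comm]
  have h := hA.dotProduct_mulVec_nonneg (x + z)
  simp only [star_trivial, Matrix.mulVec_add, add_dotProduct, dotProduct_add] at h
  linarith

/-- Lemma 4: the derivative of `V_{e_x} = ½‖e_x‖²` along the fast dynamics
satisfies `⟨e_x, ė_x⟩ ≤ −e_xᵀWLᴵe_x − ½ e_xᵀWLᴱe_x + ½ e_yᵀUᵀLᴱUe_y`. -/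
theorem lyapunov_fastVar_bound
    (r : ℕ) (Nv : Fin r → ℕ) (hNv : ∀ α, 0 < Nv α)
    (Lb : ∀ α : Fin r, Matrix (Fin (Nv α)) (Fin (Nv α)) ℝ)
    (hLb : ∀ α, (Lb α).PosSemidef)
    (LE : Matrix (ClusterNode r Nv) (ClusterNode r Nv) ℝ)
    (hLE : LE.PosSemidef)
    (ex : ClusterNode r Nv → ℝ) (hex : clusterW r Nv *ᵥ ex = ex)
    (ey : Fin r → ℝ) :
    ex ⬝ᵥ (-(clusterW r Nv *ᵥ (Matrix.blockDiagonal' Lb *ᵥ ex))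
        - clusterW r Nv *ᵥ (LE *ᵥ ex)
        - clusterW r Nv *ᵥ (LE *ᵥ (clusterU r Nv *ᵥ ey)))
      ≤ -(ex ⬝ᵥ (clusterW r Nv *ᵥ (Matrix.blockDiagonal' Lb *ᵥ ex)))
        - (1 / 2) * (ex ⬝ᵥ (clusterW r Nv *ᵥ (LE *ᵥ ex)))
        + (1 / 2) * ((clusterU r Nv *ᵥ ey) ⬝ᵥ (LE *ᵥ (clusterU r Nv *ᵥ ey))) := by
  have h := hLE.neg_dotProduct_mulVec_le ex (clusterU r Nv *ᵥ ey)
  simp only [dotProduct_sub, dotProduct_neg, dotProduct_clusterW_mulVec hex]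
  linarith
end
end

section
/- Let e_y ∈ ℝ^r with 1_rᵀ e_y = 0. Assume Lᴱ is symmetric positive semidefinite, P commutes with Uᵀ Lᴱ U, and there exists sE > 0 such that (U w)ᵀ Lᴱ (U w) ≥ sE ‖U w‖² for every w ∈ ℝ^r with 1_rᵀ w = 0. Then −e_yᵀ P⁻¹ Uᵀ Lᴱ U e_y ≤ −(N_min sE / N_max) ‖e_y‖². -/
open Matrix

noncomputable section

/-- If a positive semidefinite matrix `M` commutes with `diagonal n`, then
`e ⬝ diagonal n⁻¹ M e` dominates `b⁻¹ (e ⬝ M e)` for every upper bound `b` of the positive `n`. -/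
theorem inv_mul_dotProduct_le_of_commute_diagonal {ι : Type*} [Fintype ι] [DecidableEq ι]
    {M : Matrix ι ι ℝ} (hM : M.PosSemidef) {n : ι → ℝ} (hn : ∀ i, 0 < n i)
    {b : ℝ} (hb : ∀ i, n i ≤ b) (hcomm : diagonal n * M = M * diagonal n) (e : ι → ℝ) :
    b⁻¹ * (e ⬝ᵥ (M *ᵥ e)) ≤ e ⬝ᵥ (diagonal (fun i => (n i)⁻¹) *ᵥ (M *ᵥ e)) := by
  set d : ι → ℝ := fun i => √((n i)⁻¹ - b⁻¹) with hd
  have hdd : ∀ i, d i * d i = (n i)⁻¹ - b⁻¹ := fun i =>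
    Real.mul_self_sqrt (sub_nonneg.2 (inv_anti₀ (hn i) (hb i)))
  have hnonneg := hM.dotProduct_mulVec_nonneg (fun i => d i * e i)
  have key : e ⬝ᵥ (diagonal (fun i => (n i)⁻¹) *ᵥ (M *ᵥ e)) =
      b⁻¹ * (e ⬝ᵥ (M *ᵥ e)) + (fun i => d i * e i) ⬝ᵥ (M *ᵥ fun i => d i * e i) := by
    simp_rw [dotProduct, mulVec_diagonal]
    simp only [mulVec, dotProduct, Finset.mul_sum, ← Finset.sum_add_distrib]
    refine Finset.sum_congr rfl fun i _ => Finset.sum_congr rfl fun j _ => ?_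
    have hij : n i * M i j = M i j * n j := by
      simpa [diagonal_mul, mul_diagonal] using congrFun (congrFun hcomm i) j
    by_cases h0 : M i j = 0
    · simp [h0]
    · have hnij : n i = n j := mul_left_cancel₀ h0 (by linarith)
      have hdij : d j = d i := by simp only [hd, hnij]
      rw [hdij]
      linear_combination (-(e i * M i j * e j)) * hdd i
  rw [key]
  simpa using hnonneg

theorem clusterU_mulVec (r : ℕ) (Nv : Fin r → ℕ) (w : Fin r → ℝ) :
    clusterU r Nv *ᵥ w = fun v => w v.1 := by
  ext v
  simp [clusterU, mulVec, dotProduct]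

theorem clusterU_mulVec_dotProduct_self (r : ℕ) (Nv : Fin r → ℕ) (w : Fin r → ℝ) :
    (clusterU r Nv *ᵥ w) ⬝ᵥ (clusterU r Nv *ᵥ w) = ∑ α, (Nv α : ℝ) * (w α * w α) := by
  simp [clusterU_mulVec, dotProduct, Fintype.sum_sigma]

/-- Inequality (36): for mean-zero `e_y`, if `Lᴱ` has spectral gap `sE` on
`U`-images of mean-zero vectors and `P` commutes with `UᵀLᴱU`, then
`−e_yᵀP⁻¹UᵀLᴱU e_y ≤ −(N_min sE / N_max) ‖e_y‖²`. -/
theorem interArea_quadratic_bound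
    (r : ℕ) (Nv : Fin r → ℕ) (hNv : ∀ α, 0 < Nv α)
    (Nmin Nmax : ℕ)
    (hNmin : IsLeast (Set.range Nv) Nmin)
    (hNmax : IsGreatest (Set.range Nv) Nmax)
    (LE : Matrix (ClusterNode r Nv) (ClusterNode r Nv) ℝ)
    (hLE : LE.PosSemidef)
    (hcomm : clusterP r Nv * ((clusterU r Nv)ᵀ * LE * clusterU r Nv) =
      ((clusterU r Nv)ᵀ * LE * clusterU r Nv) * clusterP r Nv)
    (sE : ℝ) (hsE : 0 < sE)
    (hsEgapU : ∀ w : Fin r → ℝ, (∑ α, w α) = 0 →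
      sE * ((clusterU r Nv *ᵥ w) ⬝ᵥ (clusterU r Nv *ᵥ w)) ≤
        (clusterU r Nv *ᵥ w) ⬝ᵥ (LE *ᵥ (clusterU r Nv *ᵥ w)))
    (ey : Fin r → ℝ) (hey : (∑ α, ey α) = 0) :
    -(ey ⬝ᵥ (clusterPinv r Nv *ᵥ ((clusterU r Nv)ᵀ *ᵥ (LE *ᵥ (clusterU r Nv *ᵥ ey)))))
      ≤ -((Nmin : ℝ) * sE / (Nmax : ℝ)) * (ey ⬝ᵥ ey) := by
  have hpos : (0 : ℝ) < Nmax := by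
    obtain ⟨α, rfl⟩ := hNmax.1
    exact_mod_cast hNv α
  have hM : ((clusterU r Nv)ᵀ * LE * clusterU r Nv).PosSemidef := by
    simpa using hLE.conjTranspose_mul_mul_same (clusterU r Nv)
  have hlow := inv_mul_dotProduct_le_of_commute_diagonal hM
    (n := fun α => (Nv α : ℝ)) (b := Nmax) (fun α => by exact_mod_cast hNv α)
    (fun α => by exact_mod_cast hNmax.2 ⟨α, rfl⟩) hcomm ey
  have hquad : ey ⬝ᵥ (((clusterU r Nv)ᵀ * LE * clusterU r Nv) *ᵥ ey) =
      (clusterU r Nv *ᵥ ey) ⬝ᵥ (LE *ᵥ (clusterU r Nv *ᵥ ey)) := by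
    rw [← mulVec_mulVec, ← mulVec_mulVec, dotProduct_mulVec, vecMul_transpose]
  have hnorm : (Nmin : ℝ) * (ey ⬝ᵥ ey) ≤
      (clusterU r Nv *ᵥ ey) ⬝ᵥ (clusterU r Nv *ᵥ ey) := by
    rw [clusterU_mulVec_dotProduct_self, dotProduct, Finset.mul_sum]
    refine Finset.sum_le_sum fun α _ => mul_le_mul_of_nonneg_right ?_ (mul_self_nonneg _)
    exact_mod_cast hNmin.2 ⟨α, rfl⟩
  have hgap : sE * ((Nmin : ℝ) * (ey ⬝ᵥ ey)) ≤
      ey ⬝ᵥ (((clusterU r Nv)ᵀ * LE * clusterU r Nv) *ᵥ ey) :=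
    hquad ▸ (mul_le_mul_of_nonneg_left hnorm hsE.le).trans (hsEgapU ey hey)
  have hbound := (mul_le_mul_of_nonneg_left hgap (inv_nonneg.2 hpos.le)).trans hlow
  rw [← mulVec_mulVec, ← mulVec_mulVec] at hbound
  rw [neg_mul, neg_le_neg_iff]
  calc (Nmin : ℝ) * sE / Nmax * (ey ⬝ᵥ ey)
      = (Nmax : ℝ)⁻¹ * (sE * ((Nmin : ℝ) * (ey ⬝ᵥ ey))) := by ring
    _ ≤ _ := hbound
end
end
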